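/- For all integers t ≥ 2 and m, n with 4^t ≤ n ≤ m^{1/(2(t−1))}, s(m,n,t) ≥ (1/15) · m^{(1/(t−1))·(1 − 4^t/n)}. -/

import Mathlib

/-- A Boolean decision tree over an `s`-bit memory: each internal node probes a
bit at an index in `[s]`, each leaf is marked Yes (`true`) or No (`false`). -/
inductive DTree (s : ℕ) : Type
  | leaf (b : Bool) : DTree s
  | node (i : Fin s) (f0 f1 : DTree s) : DTree s

/-- Depth of a decision tree. -/
def DTree.depth {s : ℕ} : DTree s → ℕ
  | .leaf _ => 0
  | .node _ f0 f1 => max f0.depth f1.depth + 1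

/-- Evaluating a decision tree on a memory `σ : Fin s → Bool`: at a node probing
index `i`, follow the edge labeled by the bit `σ i`. -/
def DTree.eval {s : ℕ} : DTree s → (Fin s → Bool) → Bool
  | .leaf b, _ => b
  | .node i f0 f1, σ => if σ i then f1.eval σ else f0.eval σ

/-- An `(m,n,s,t)`-scheme: a storing scheme `φ` mapping subsets of `[m]` of size at
most `n` to `s`-bit strings, together with a family of decision trees of depth at
most `t` answering membership queries correctly. -/
def SchemeExists (m n s t : ℕ) : Prop :=
  ∃ (φ : Finset (Fin m) → (Fin s → Bool)) (T : Fin m → DTree s),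
    (∀ u : Fin m, (T u).depth ≤ t) ∧
    ∀ S : Finset (Fin m), S.card ≤ n → ∀ u : Fin m, ((T u).eval (φ S) = true ↔ u ∈ S)

/-- `sFun m n t` is the minimum `s` such that an `(m,n,s,t)`-scheme exists. -/
noncomputable def sFun (m n t : ℕ) : ℕ := sInf {s : ℕ | SchemeExists m n s t}

section Propagation

variable {α X Y : Type*}

/-- The memory `(σX, σY)` obeys every edge of `B`: an edge `e` whose first cell `x e` holds its
role `r e` forces its second cell `y e` to hold `q e`. -/
def Obeys (x : α → X) (y : α → Y) (r : α → Bool) (B : Finset α) (q : α → Bool)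
    (σX : X → Bool) (σY : Y → Bool) : Prop :=
  ∀ e ∈ B, σX (x e) = r e → σY (y e) = q e

variable {x : α → X} {y : α → Y} {r : α → Bool}

theorem Obeys.mono {A B : Finset α} {q q' : α → Bool} {σX : X → Bool} {σY : Y → Bool}
    (h : Obeys x y r A q σX σY) (hBA : B ⊆ A) (hq : ∀ e ∈ B, q e = q' e) :
    Obeys x y r B q' σX σY :=
  fun e he hx => (h e (hBA he) hx).trans (hq e he)

variable [DecidableEq X] [DecidableEq Y]

/-- The edges that are active as soon as one of the literals in `L` holds. -/
def outEdges (x : α → X) (r : α → Bool) (E : Finset α) (L : Finset (X × Bool)) : Finset α :=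
  E.filter fun e => (x e, r e) ∈ L

/-- `B` is a set of at most `k` edges, with second cells in `R`, at most one of which disagrees
with `a` over each second cell. -/
structure IsSupport (y : α → Y) (E : Finset α) (q : α → Bool) (a : Y → Bool) (R : Finset Y)
    (k : ℕ) (B : Finset α) : Prop where
  subset : B ⊆ E
  card_le : B.card ≤ k
  mem : ∀ e ∈ B, y e ∈ R
  fiber : ∀ z, (B.filter fun e => y e = z ∧ q e ≠ a z).card ≤ 1

/-- The state after `k` rounds of propagation from the assumption that cell `i` holds `v`:
`L` collects the derived literals, and `R` the second cells `z` whose content `a z` is derived. -/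
structure IsState (x : α → X) (y : α → Y) (r : α → Bool) (E A₀ : Finset α) (q₀ : α → Bool)
    (c : ℕ) (i : X) (v : Bool) (k : ℕ) (q : α → Bool) (a : Y → Bool) (R : Finset Y)
    (L : Finset (X × Bool)) : Prop where
  agree : ∀ e ∈ A₀, q e = q₀ e
  subset : R ⊆ E.image y
  lit : ∀ l ∈ L, ∃ B, IsSupport y E q a R (2 * k) B ∧
    ∀ σX σY, Obeys x y r B q σX σY → σX i = v → σX l.1 = l.2
  cell : ∀ z ∈ R, ∃ B, IsSupport y E q a R (2 * k) B ∧
    ∀ σX σY, Obeys x y r B q σX σY → σX i = v → σY z = a z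
  fiber : ∀ z ∈ R, (E.filter fun e => y e = z ∧ q e = a z).card ≤ c + 1
  closed : ∀ f ∈ E, y f ∈ R → q f ≠ a (y f) → (x f, !r f) ∈ L

/-- At most `K` edges of `E`, with labels extending `q₀` on `A₀`, refute that cell `i` holds `v`;
over each second cell, one of the labels is used at most `c + 1` times and the other at most
three times. -/
def IsRefuted (x : α → X) (y : α → Y) (r : α → Bool) (E A₀ : Finset α) (q₀ : α → Bool)
    (c : ℕ) (i : X) (v : Bool) (K : ℕ) : Prop :=
  ∃ A q, A ⊆ E ∧ (∀ e ∈ A₀, q e = q₀ e) ∧ A.card ≤ K ∧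
    (∀ σX σY, Obeys x y r A q σX σY → σX i ≠ v) ∧
    ∀ z, ∃ b, (A.filter fun e => y e = z ∧ q e = b).card ≤ c + 1 ∧
      (A.filter fun e => y e = z ∧ q e ≠ b).card ≤ 3

variable {E A₀ : Finset α} {q₀ : α → Bool} {c k K : ℕ} {i : X} {v : Bool} {q : α → Bool}
  {a : Y → Bool} {R : Finset Y} {L : Finset (X × Bool)}

theorem IsSupport.mono {q' : α → Bool} {a' : Y → Bool} {R' : Finset Y} {k' : ℕ} {B : Finset α}
    (h : IsSupport y E q a R k B) (hR : R ⊆ R') (hk : k ≤ k')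
    (hq : ∀ e ∈ E, y e ∈ R → q' e = q e) (ha : ∀ z ∈ R, a' z = a z) :
    IsSupport y E q' a' R' k' B where
  subset := h.subset
  card_le := h.card_le.trans hk
  mem e he := hR (h.mem e he)
  fiber z := by
    refine le_trans (Finset.card_le_card fun e he => ?_) (h.fiber z)
    simp only [Finset.mem_filter] at he ⊢
    obtain ⟨heB, rfl, hne⟩ := he
    have hm := h.mem e heB
    rw [hq e (h.subset heB) hm, ha _ hm] at hne
    exact ⟨heB, rfl, hne⟩

variable [DecidableEq α]

/-- Two supports that derive the two ends of a conflict on a cell outside `R` refute. -/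
theorem IsState.refuted_of_new (h : IsState x y r E A₀ q₀ c i v k q a R L) {e e' : α}
    (he : e ∈ outEdges x r E L) (he' : e' ∈ outEdges x r E L) (hy : y e = y e') (hR : y e ∉ R)
    {q' : α → Bool} (hq' : ∀ f, y f ≠ y e → q' f = q f) (hagree : ∀ f ∈ A₀, q' f = q₀ f)
    (hne : q' e ≠ q' e') (hK : 4 * k + 2 ≤ K) : IsRefuted x y r E A₀ q₀ c i v K := by
  simp only [outEdges, Finset.mem_filter] at he he'
  obtain ⟨B, hB, hBl⟩ := h.lit _ he.2
  obtain ⟨B', hB', hBl'⟩ := h.lit _ he'.2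
  have hqR : ∀ f, y f ∈ R → q' f = q f := fun f hf => hq' f fun hh => hR (hh ▸ hf)
  refine ⟨(B ∪ B') ∪ {e, e'}, q', ?_, hagree, ?_, ?_, ?_⟩
  · intro f hf
    simp only [Finset.mem_union, Finset.mem_insert, Finset.mem_singleton] at hf
    rcases hf with (hf | hf) | rfl | rfl
    exacts [hB.subset hf, hB'.subset hf, he.1, he'.1]
  · have h1 := Finset.card_union_le (B ∪ B') {e, e'}
    have h2 := Finset.card_union_le B B'
    have h3 : ({e, e'} : Finset α).card ≤ 2 := Finset.card_le_two
    have := hB.card_le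
    have := hB'.card_le
    omega
  · intro σX σY hσ hi
    have h1 := hBl σX σY (hσ.mono (fun f hf => by simp [hf]) fun f hf => hqR f (hB.mem f hf)) hi
    have h2 := hBl' σX σY (hσ.mono (fun f hf => by simp [hf]) fun f hf => hqR f (hB'.mem f hf)) hi
    have h3 := hσ e (by simp) h1
    have h4 := hσ e' (by simp) h2
    rw [hy, h4] at h3
    exact hne h3.symm
  · intro z
    by_cases hz : z ∈ R
    · have hze : y e ≠ z := fun hh => hR (hh ▸ hz)
      have hze' : y e' ≠ z := hy ▸ hze
      refine ⟨a z, le_trans (Finset.card_le_card fun f hf => ?_) (h.fiber z hz), ?_⟩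
      · simp only [Finset.mem_filter, Finset.mem_union, Finset.mem_insert,
          Finset.mem_singleton] at hf ⊢
        obtain ⟨hf, rfl, hfa⟩ := hf
        rw [hqR f hz] at hfa
        rcases hf with (hf | hf) | rfl | rfl
        exacts [⟨hB.subset hf, rfl, hfa⟩, ⟨hB'.subset hf, rfl, hfa⟩, absurd rfl hze,
          absurd rfl hze']
      · have hsub : (((B ∪ B') ∪ {e, e'}).filter fun f => y f = z ∧ q' f ≠ a z) ⊆
            (B.filter fun f => y f = z ∧ q f ≠ a z) ∪
              (B'.filter fun f => y f = z ∧ q f ≠ a z) := by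
          intro f hf
          simp only [Finset.mem_filter, Finset.mem_union, Finset.mem_insert,
            Finset.mem_singleton] at hf ⊢
          obtain ⟨hf, rfl, hfa⟩ := hf
          rw [hqR f hz] at hfa
          rcases hf with (hf | hf) | rfl | rfl
          exacts [Or.inl ⟨hf, rfl, hfa⟩, Or.inr ⟨hf, rfl, hfa⟩, absurd rfl hze, absurd rfl hze']
        have h1 := Finset.card_le_card hsub
        have h2 := Finset.card_union_le (B.filter fun f => y f = z ∧ q f ≠ a z)
              (B'.filter fun f => y f = z ∧ q f ≠ a z)
        have := hB.fiber z
        have := hB'.fiber z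
        omega
    · have hsub : ∀ f ∈ (B ∪ B') ∪ {e, e'}, y f = z → f = e ∨ f = e' := by
        rintro f hf rfl
        simp only [Finset.mem_union, Finset.mem_insert, Finset.mem_singleton] at hf
        rcases hf with (hf | hf) | hf
        exacts [absurd (hB.mem f hf) hz, absurd (hB'.mem f hf) hz, hf]
      refine ⟨q' e, (Finset.card_le_card (t := {e}) fun f hf => ?_).trans (by simp),
        (Finset.card_le_card (t := {e'}) fun f hf => ?_).trans (by simp)⟩ <;>
      · simp only [Finset.mem_filter] at hf
        obtain ⟨hf, hfz, hfq⟩ := hf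
        rcases hsub f hf hfz with rfl | rfl
        · simp_all
        · simp_all

/-- An active edge that disagrees with an already derived cell content refutes. -/
theorem IsState.refuted_of_old (h : IsState x y r E A₀ q₀ c i v k q a R L) {e : α}
    (he : e ∈ outEdges x r E L) (hR : y e ∈ R) (hne : q e ≠ a (y e)) (hK : 4 * k + 2 ≤ K) :
    IsRefuted x y r E A₀ q₀ c i v K := by
  simp only [outEdges, Finset.mem_filter] at he
  obtain ⟨B, hB, hBl⟩ := h.lit _ he.2
  obtain ⟨B', hB', hBl'⟩ := h.cell _ hR
  have hE : insert e (B ∪ B') ⊆ E := by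
    intro f hf
    simp only [Finset.mem_union, Finset.mem_insert] at hf
    rcases hf with rfl | hf | hf
    exacts [he.1, hB.subset hf, hB'.subset hf]
  have hmem : ∀ f ∈ insert e (B ∪ B'), y f ∈ R := by
    intro f hf
    simp only [Finset.mem_union, Finset.mem_insert] at hf
    rcases hf with rfl | hf | hf
    exacts [hR, hB.mem f hf, hB'.mem f hf]
  refine ⟨insert e (B ∪ B'), q, hE, h.agree, ?_, ?_, ?_⟩
  · have h1 := Finset.card_insert_le e (B ∪ B')
    have h2 := Finset.card_union_le B B'
    have := hB.card_le
    have := hB'.card_le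
    omega
  · intro σX σY hσ hi
    have h1 := hBl σX σY (hσ.mono (fun f hf => by simp [hf]) fun f hf => rfl) hi
    have h2 := hBl' σX σY (hσ.mono (fun f hf => by simp [hf]) fun f hf => rfl) hi
    have h3 := hσ e (by simp) h1
    exact hne (h3.symm.trans h2)
  · intro z
    refine ⟨a z, ?_, ?_⟩
    · by_cases hz : z ∈ R
      · exact (Finset.card_le_card (Finset.filter_subset_filter _ hE)).trans (h.fiber z hz)
      · rw [Finset.filter_false_of_mem]
        · simp
        · rintro f hf ⟨rfl, -⟩
          exact hz (hmem f hf)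
    · have h1 : ((insert e (B ∪ B')).filter fun f => y f = z ∧ q f ≠ a z).card ≤
          ((B ∪ B').filter fun f => y f = z ∧ q f ≠ a z).card + 1 := by
        rw [Finset.filter_insert]
        split_ifs
        exacts [Finset.card_insert_le _ _, Nat.le_succ _]
      rw [Finset.filter_union] at h1
      have h2 := Finset.card_union_le (B.filter fun f => y f = z ∧ q f ≠ a z)
            (B'.filter fun f => y f = z ∧ q f ≠ a z)
      have := hB.fiber z
      have := hB'.fiber z
      omega

theorem IsState.eq_of_new (h : IsState x y r E A₀ q₀ c i v k q a R L)
    (hno : ¬ IsRefuted x y r E A₀ q₀ c i v K) (hK : 4 * k + 2 ≤ K) {e e' : α}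
    (he : e ∈ outEdges x r E L) (he' : e' ∈ outEdges x r E L) (hy : y e = y e') (hR : y e ∉ R)
    (hne : e ≠ e') : e ∈ A₀ ∧ e' ∈ A₀ ∧ q e = q e' := by
  have key := fun q' h1 h2 h3 => hno (h.refuted_of_new (q' := q') he he' hy hR h1 h2 h3 hK)
  have hA : e ∈ A₀ := by
    by_contra hA
    refine key (Function.update q e (!q e')) (fun f hf => ?_) (fun f hf => ?_) ?_
    · rw [Function.update_of_ne (fun hh => hf (by rw [hh]))]
    · rw [Function.update_of_ne (fun hh => hA (by rwa [← hh])), h.agree f hf]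
    · rw [Function.update_self, Function.update_of_ne hne.symm]
      simp
  have hA' : e' ∈ A₀ := by
    by_contra hA
    refine key (Function.update q e' (!q e)) (fun f hf => ?_) (fun f hf => ?_) ?_
    · rw [Function.update_of_ne (fun hh => hf (by rw [hh, hy]))]
    · rw [Function.update_of_ne (fun hh => hA (by rwa [← hh])), h.agree f hf]
    · rw [Function.update_self, Function.update_of_ne hne]
      simp
  refine ⟨hA, hA', ?_⟩
  by_contra hq
  exact key q (fun _ _ => rfl) h.agree hq

theorem IsState.exists_step (h : IsState x y r E A₀ q₀ c i v k q a R L)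
    (hA : ∀ z, ∃ b, (A₀.filter fun e => y e = z ∧ q₀ e = b).card ≤ c ∧
      (A₀.filter fun e => y e = z ∧ q₀ e ≠ b).card ≤ c + 1)
    (hno : ¬ IsRefuted x y r E A₀ q₀ c i v K) (hK : 4 * k + 2 ≤ K) :
    ∃ q' a' R' L', IsState x y r E A₀ q₀ c i v (k + 1) q' a' R' L' ∧
      (outEdges x r E L).card ≤ (c + 1) * R'.card := by
  classical
  choose b hb hb' using hA
  set O := outEdges x r E L with hO
  have hOE : O ⊆ E := Finset.filter_subset _ _
  let a' : Y → Bool := fun z =>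
    if z ∈ R then a z
    else if hz : ∃ e ∈ O, e ∈ A₀ ∧ y e = z then q hz.choose else b z
  let q' : α → Bool := fun f =>
    if f ∈ A₀ ∨ y f ∈ R then q f else if f ∈ O then a' (y f) else !a' (y f)
  have haR : ∀ z ∈ R, a' z = a z := fun z hz => if_pos hz
  have hqR : ∀ f, y f ∈ R → q' f = q f := fun f hf => if_pos (Or.inr hf)
  have hqA : ∀ f ∈ A₀, q' f = q f := fun f hf => if_pos (Or.inl hf)
  have haA : ∀ e ∈ O, e ∈ A₀ → y e ∉ R → a' (y e) = q e := by
    intro e he heA hR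
    have hex : ∃ e' ∈ O, e' ∈ A₀ ∧ y e' = y e := ⟨e, he, heA, rfl⟩
    have : a' (y e) = q hex.choose := by simp only [a', if_neg hR, dif_pos hex]
    rw [this]
    obtain ⟨h1, h2, h3⟩ := hex.choose_spec
    by_cases hee : hex.choose = e
    · rw [hee]
    · exact (h.eq_of_new hno hK h1 he h3 (by rwa [h3]) hee).2.2
  have hOq : ∀ e ∈ O, q' e = a' (y e) := by
    intro e he
    by_cases hR : y e ∈ R
    · rw [hqR e hR, haR _ hR]
      by_contra hne
      exact hno (h.refuted_of_old he hR hne hK)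
    · by_cases heA : e ∈ A₀
      · rw [hqA e heA, haA e he heA hR]
      · simp only [q', heA, hR, he, or_self, if_false, if_true]
  have hfib : ∀ z ∈ R ∪ O.image y, (E.filter fun e => y e = z ∧ q' e = a' z).card ≤ c + 1 := by
    intro z hz
    by_cases hR : z ∈ R
    · refine le_trans (Finset.card_le_card fun f hf => ?_) (h.fiber z hR)
      simp only [Finset.mem_filter] at hf ⊢
      obtain ⟨hf, rfl, hfq⟩ := hf
      rw [hqR f hR, haR _ hR] at hfq
      exact ⟨hf, rfl, hfq⟩
    · have hsub : (E.filter fun e => y e = z ∧ q' e = a' z) ⊆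
          (A₀.filter fun e => y e = z ∧ q₀ e = a' z) ∪ (O.filter fun e => e ∉ A₀ ∧ y e = z) := by
        intro f hf
        simp only [Finset.mem_filter, Finset.mem_union] at hf ⊢
        obtain ⟨hf, rfl, hfq⟩ := hf
        by_cases hfA : f ∈ A₀
        · rw [hqA f hfA, h.agree f hfA] at hfq
          exact Or.inl ⟨hfA, rfl, hfq⟩
        · refine Or.inr ⟨?_, hfA, rfl⟩
          by_contra hfO
          simp [q', hfA, hR, hfO] at hfq
      have h1 := (Finset.card_le_card hsub).trans (Finset.card_union_le _ _)
      by_cases hex : ∃ e ∈ O, e ∈ A₀ ∧ y e = z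
      · have h2 : O.filter (fun e => e ∉ A₀ ∧ y e = z) = ∅ := by
          obtain ⟨e', he', heA', rfl⟩ := hex
          refine Finset.filter_false_of_mem ?_
          rintro e he ⟨heA, hey⟩
          exact heA (h.eq_of_new hno hK he he' hey (hey ▸ hR) fun hh => heA (hh ▸ heA')).1
        have h3 : (A₀.filter fun e => y e = z ∧ q₀ e = a' z).card ≤ c + 1 := by
          by_cases hab : a' z = b z
          · rw [hab]
            exact (hb z).trans (Nat.le_succ _)
          · refine le_trans (Finset.card_le_card fun f hf => ?_) (hb' z)
            simp only [Finset.mem_filter] at hf ⊢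
            exact ⟨hf.1, hf.2.1, hf.2.2 ▸ hab⟩
        rw [h2, Finset.card_empty] at h1
        omega
      · have hab : a' z = b z := by simp only [a', if_neg hR, dif_neg hex]
        have h2 : (O.filter fun e => e ∉ A₀ ∧ y e = z).card ≤ 1 := by
          refine Finset.card_le_one.2 fun e he e' he' => ?_
          simp only [Finset.mem_filter] at he he'
          by_contra hne
          exact he.2.1 (h.eq_of_new hno hK he.1 he'.1 (he.2.2.trans he'.2.2.symm)
            (he.2.2 ▸ hR) hne).1
        have := hb z
        rw [hab] at h1
        rw [hab]
        omega
  have hcell : ∀ z ∈ O.image y, z ∉ R →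
      ∃ B e, e ∈ O ∧ y e = z ∧ IsSupport y E q a R (2 * k) B ∧
        ∀ σX σY, Obeys x y r (insert e B) q' σX σY → σX i = v → σY z = a' z := by
    intro z hz hR
    obtain ⟨e, he, rfl⟩ := Finset.mem_image.1 hz
    obtain ⟨B, hB, hBl⟩ := h.lit _ (Finset.mem_filter.1 he).2
    refine ⟨B, e, he, rfl, hB, fun σX σY hσ hi => ?_⟩
    rw [← hOq e he]
    exact hσ e (by simp) (hBl σX σY
      (hσ.mono (fun f hf => by simp [hf]) fun f hf => hqR f (hB.mem f hf)) hi)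
  have hsup : ∀ B e, e ∈ O → y e ∉ R → IsSupport y E q a R (2 * k) B →
      IsSupport y E q' a' (R ∪ O.image y) (2 * k + 1) (insert e B) := by
    intro B e he hR hB
    have hB' := hB.mono (q' := q') (a' := a') (R' := R ∪ O.image y) (k' := 2 * k)
      Finset.subset_union_left le_rfl (fun f _ => hqR f) haR
    refine ⟨Finset.insert_subset (hOE he) hB.subset,
      (Finset.card_insert_le _ _).trans (Nat.succ_le_succ hB.card_le), fun f hf => ?_,
      fun z => ?_⟩
    · rcases Finset.mem_insert.1 hf with rfl | hf
      exacts [Finset.mem_union_right _ (Finset.mem_image_of_mem _ he), hB'.mem f hf]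
    · rw [Finset.filter_insert, if_neg]
      · exact hB'.fiber z
      · rintro ⟨rfl, hne⟩
        exact hne (hOq e he)
  refine ⟨q', a', R ∪ O.image y,
    L ∪ (E.filter fun f => y f ∈ R ∪ O.image y ∧ q' f ≠ a' (y f)).image fun f => (x f, !r f),
    ⟨fun e he => (hqA e he).trans (h.agree e he),
      Finset.union_subset h.subset (Finset.image_subset_image hOE), ?_, ?_, hfib, ?_⟩, ?_⟩
  · have hold : ∀ l ∈ L, ∃ B, IsSupport y E q' a' (R ∪ O.image y) (2 * (k + 1)) B ∧
        ∀ σX σY, Obeys x y r B q' σX σY → σX i = v → σX l.1 = l.2 := by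
      intro l hl
      obtain ⟨B, hB, hBl⟩ := h.lit l hl
      exact ⟨B, hB.mono Finset.subset_union_left (by omega) (fun f _ => hqR f) haR,
        fun σX σY hσ hi => hBl σX σY (hσ.mono subset_rfl fun f hf => hqR f (hB.mem f hf)) hi⟩
    intro l hl
    rcases Finset.mem_union.1 hl with hl | hl
    · exact hold l hl
    · obtain ⟨f, hf, rfl⟩ := Finset.mem_image.1 hl
      simp only [Finset.mem_filter] at hf
      obtain ⟨hfE, hfR, hfq⟩ := hf
      by_cases hR : y f ∈ R
      · rw [hqR f hR, haR _ hR] at hfq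
        exact hold _ (h.closed f hfE hR hfq)
      · obtain ⟨B, e, he, hey, hB, hBc⟩ := hcell _ ((Finset.mem_union.1 hfR).resolve_left hR) hR
        have hS := hsup B e he (hey ▸ hR) hB
        refine ⟨insert f (insert e B), ⟨Finset.insert_subset hfE hS.subset,
          (Finset.card_insert_le _ _).trans (Nat.succ_le_succ hS.card_le), fun g hg => ?_,
          fun z => ?_⟩, fun σX σY hσ hi => ?_⟩
        · rcases Finset.mem_insert.1 hg with rfl | hg
          exacts [hfR, hS.mem g hg]
        · by_cases hz : y f = z
          · refine (Finset.card_le_card (t := {f}) fun g hg => ?_).trans (by simp)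
            simp only [Finset.mem_filter, Finset.mem_insert] at hg
            obtain ⟨rfl | rfl | hg, hgz, hgq⟩ := hg
            · simp
            · rw [← hgz] at hgq
              exact absurd (hOq _ he) hgq
            · exact absurd (hB.mem g hg) (by rwa [hgz, ← hz])
          · rw [Finset.filter_insert, if_neg fun hh => hz hh.1]
            exact hS.fiber z
        · have h1 := hBc σX σY (hσ.mono (Finset.subset_insert _ _) fun _ _ => rfl) hi
          have h2 := hσ f (by simp)
          change σX (x f) = !r f
          by_contra hne
          exact hfq ((h2 (by simpa using hne)).symm.trans h1)
  · intro z hz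
    by_cases hR : z ∈ R
    · obtain ⟨B, hB, hBl⟩ := h.cell z hR
      exact ⟨B, hB.mono Finset.subset_union_left (by omega) (fun f _ => hqR f) haR,
        fun σX σY hσ hi => (hBl σX σY
          (hσ.mono subset_rfl fun f hf => hqR f (hB.mem f hf)) hi).trans (haR z hR).symm⟩
    · obtain ⟨B, e, he, hey, hB, hBc⟩ := hcell z ((Finset.mem_union.1 hz).resolve_left hR) hR
      exact ⟨insert e B, (hsup B e he (hey ▸ hR) hB).mono subset_rfl (by omega)
        (fun _ _ _ => rfl) fun _ _ => rfl, hBc⟩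
  · intro f hf hfR hfq
    exact Finset.mem_union_right _ (Finset.mem_image_of_mem (fun f => (x f, !r f))
      (Finset.mem_filter.2 ⟨hf, hfR, hfq⟩))
  · refine Finset.card_le_mul_card_image_of_maps_to (f := y)
      (fun e he => Finset.mem_union_right _ (Finset.mem_image_of_mem _ he)) _ fun z hz => ?_
    refine le_trans (Finset.card_le_card fun e he => ?_) (hfib z hz)
    simp only [Finset.mem_filter] at he ⊢
    obtain ⟨he, rfl⟩ := he
    exact ⟨hOE he, rfl, hOq e he⟩

/-- **Propagation lemma.** If literals are balanced and every second cell in use has large degree,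
then every literal with an active edge has a small refutation. -/
theorem isRefuted_of_degree [Fintype Y]
    (hA : ∀ z, ∃ b, (A₀.filter fun e => y e = z ∧ q₀ e = b).card ≤ c ∧
      (A₀.filter fun e => y e = z ∧ q₀ e ≠ b).card ≤ c + 1)
    (hbal : ∀ L : Finset (X × Bool), (outEdges x r E L).card =
      (E.filter fun e => (x e, !r e) ∈ L).card)
    {M : ℝ} (hM : 0 ≤ M)
    (hdeg : ∀ z ∈ E.image y, M * (c + 1) + (c + 1) ≤ (E.filter fun e => y e = z).card)
    (hstart : ∃ e ∈ E, x e = i ∧ r e = v) {h : ℕ} (hh : (Fintype.card Y : ℝ) < M ^ h) :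
    IsRefuted x y r E A₀ q₀ c i v (4 * h + 2) := by
  by_contra hno
  have hc : (0 : ℝ) < c + 1 := by positivity
  have key : ∀ k ≤ h, ∃ q a R L, IsState x y r E A₀ q₀ c i v (k + 1) q a R L ∧
      M ^ k ≤ (R.card : ℝ) := by
    intro k
    induction k with
    | zero =>
      intro _
      have h0 : IsState x y r E A₀ q₀ c i v 0 q₀ (fun _ => false) ∅ {(i, v)} := by
        refine ⟨fun _ _ => rfl, Finset.empty_subset _, fun l hl => ⟨∅, ⟨?_, ?_, ?_, ?_⟩, ?_⟩, ?_,
          ?_, ?_⟩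
        all_goals simp_all
      obtain ⟨q, a, R, L, hS, hcard⟩ := h0.exists_step hA hno (by omega)
      refine ⟨q, a, R, L, hS, ?_⟩
      obtain ⟨e, he, hex, her⟩ := hstart
      have hpos : 0 < (outEdges x r E {(i, v)}).card :=
        Finset.card_pos.2 ⟨e, by simp [outEdges, he, hex, her]⟩
      have : 0 < R.card := by
        by_contra h0
        rw [not_lt, Nat.le_zero] at h0
        rw [h0] at hcard
        omega
      rw [pow_zero]
      exact_mod_cast this
    | succ k ih =>
      intro hk
      obtain ⟨q, a, R, L, hS, hR⟩ := ih (by omega)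
      obtain ⟨q', a', R', L', hS', hcard⟩ := hS.exists_step hA hno (by omega)
      refine ⟨q', a', R', L', hS', ?_⟩
      have h1 : M * (c + 1) * R.card ≤ (outEdges x r E L).card := by
        rw [hbal]
        have hsub : (E.filter fun f => y f ∈ R ∧ q f ≠ a (y f)) ⊆
            E.filter fun e => (x e, !r e) ∈ L := by
          intro f hf
          simp only [Finset.mem_filter] at hf ⊢
          exact ⟨hf.1, hS.closed f hf.1 hf.2.1 hf.2.2⟩
        have hsum : (E.filter fun f => y f ∈ R ∧ q f ≠ a (y f)).card =
            ∑ z ∈ R, (E.filter fun f => y f = z ∧ q f ≠ a z).card := by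
          rw [Finset.card_eq_sum_card_fiberwise (f := y) (t := R)]
          · refine Finset.sum_congr rfl fun z hz => ?_
            rw [Finset.filter_filter]
            congr 1
            refine Finset.filter_congr fun f _ => ?_
            constructor
            · rintro ⟨⟨-, h1⟩, rfl⟩
              exact ⟨rfl, h1⟩
            · rintro ⟨rfl, h1⟩
              exact ⟨⟨hz, h1⟩, rfl⟩
          · intro f hf
            simp only [Finset.coe_filter, Set.mem_ofPred_eq] at hf
            exact hf.2.1
        have hle : M * (c + 1) * R.card ≤
            ((E.filter fun f => y f ∈ R ∧ q f ≠ a (y f)).card : ℝ) := by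
          rw [hsum, Nat.cast_sum, mul_comm, ← nsmul_eq_mul]
          refine Finset.card_nsmul_le_sum _ _ _ fun z hz => ?_
          have h1 := hdeg z (hS.subset hz)
          have h2 := hS.fiber z hz
          have h3 : (E.filter fun e => y e = z).card =
              (E.filter fun e => y e = z ∧ q e = a z).card +
                (E.filter fun e => y e = z ∧ q e ≠ a z).card := by
            rw [← Finset.card_filter_add_card_filter_not (s := E.filter fun e => y e = z)
              (fun e => q e = a z), Finset.filter_filter, Finset.filter_filter]
          rw [h3, Nat.cast_add] at h1
          have h2' : ((E.filter fun e => y e = z ∧ q e = a z).card : ℝ) ≤ c + 1 := by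
            exact_mod_cast h2
          linarith
        exact hle.trans (by exact_mod_cast Finset.card_le_card hsub)
      have h2 : ((outEdges x r E L).card : ℝ) ≤ (c + 1) * R'.card := by exact_mod_cast hcard
      have h3 : M * R.card ≤ R'.card := by
        refine le_of_mul_le_mul_left ?_ hc
        linarith
      calc M ^ (k + 1) = M * M ^ k := pow_succ' _ _
        _ ≤ M * R.card := by gcongr
        _ ≤ _ := h3
  obtain ⟨q, a, R, L, -, hR⟩ := key h le_rfl
  have : (R.card : ℝ) ≤ Fintype.card Y := by exact_mod_cast Finset.card_le_univ R
  linarith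

/-- Propagating from both values of a cell yields few labelled edges that no memory obeys. -/
theorem exists_not_obeys [Fintype Y] {M : ℝ} {h : ℕ} (hM : 0 ≤ M)
    (hbal : ∀ L : Finset (X × Bool),
      (outEdges x r E L).card = (E.filter fun e => (x e, !r e) ∈ L).card)
    (hdeg : ∀ z ∈ E.image y, 3 * M + 3 ≤ (E.filter fun e => y e = z).card)
    (hstart : ∀ v, ∃ e ∈ E, x e = i ∧ r e = v) (hh : (Fintype.card Y : ℝ) < M ^ h) :
    ∃ A ⊆ E, A.card ≤ 8 * h + 4 ∧ ∃ q, ∀ σX σY, ¬ Obeys x y r A q σX σY := by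
  obtain ⟨A₁, q₁, hA₁, -, hc₁, hf₁, hfib⟩ :=
    isRefuted_of_degree (x := x) (y := y) (r := r) (E := E) (A₀ := ∅) (q₀ := fun _ => false)
      (c := 0) (by simp) hbal hM
      (fun z hz => by have := hdeg z hz; push_cast; linarith) (hstart false) hh
  obtain ⟨A₂, q₂, hA₂, hagree, hc₂, hf₂, -⟩ :=
    isRefuted_of_degree (x := x) (y := y) (r := r) (E := E) (A₀ := A₁) (q₀ := q₁) (c := 2)
      (fun z => by
        obtain ⟨b, h1, h2⟩ := hfib z
        exact ⟨b, h1.trans (by norm_num), h2⟩) hbal hM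
      (fun z hz => by have := hdeg z hz; push_cast; linarith) (hstart true) hh
  refine ⟨A₁ ∪ A₂, Finset.union_subset hA₁ hA₂, (Finset.card_union_le _ _).trans (by omega), q₂,
    fun σX σY hO => ?_⟩
  have h1 := hf₁ σX σY (hO.mono Finset.subset_union_left hagree)
  have h2 := hf₂ σX σY (hO.mono Finset.subset_union_right fun _ _ => rfl)
  cases hi : σX i <;> simp_all

end Propagation

section Pairs

variable {β ι Y κ : Type*}

/-- A system of edges grouped in pairs, with few end points, has a subsystem all of whose end
points have large degree. -/
theorem exists_subset_degree_gt [DecidableEq β] [DecidableEq Y] (f : β × Bool → Y) (d : ℕ)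
    (P : Finset β) (hP : d * ((P ×ˢ Finset.univ).image f).card < P.card) :
    ∃ Q ⊆ P, Q.Nonempty ∧ ∀ z ∈ (Q ×ˢ Finset.univ).image f,
      d < ((Q ×ˢ Finset.univ).filter fun e => f e = z).card := by
  induction P using Finset.strongInduction with
  | H P ih =>
    by_cases hz : ∀ z ∈ (P ×ˢ Finset.univ).image f,
      d < ((P ×ˢ Finset.univ).filter fun e => f e = z).card
    · exact ⟨P, subset_rfl, Finset.card_pos.1 (by omega), hz⟩
    push Not at hz
    obtain ⟨z, hz, hd⟩ := hz
    set P' := P.filter fun p => ∀ b, f (p, b) ≠ z with hP'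
    have hsub : P' ⊆ P := Finset.filter_subset _ _
    have himg : (P' ×ˢ Finset.univ).image f ⊆ ((P ×ˢ Finset.univ).image f).erase z := by
      intro w hw
      simp only [Finset.mem_image, Finset.mem_product, Finset.mem_univ, and_true,
        Finset.mem_erase, hP', Finset.mem_filter] at hw ⊢
      obtain ⟨⟨p, b⟩, ⟨hp, hne⟩, rfl⟩ := hw
      exact ⟨hne b, (p, b), hp, rfl⟩
    have hrem : P.card ≤ P'.card + d := by
      rw [← Finset.card_filter_add_card_filter_not (s := P) fun p => ∀ b, f (p, b) ≠ z]
      refine Nat.add_le_add_left (le_trans ?_ hd) _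
      refine le_trans (Finset.card_le_card (t := ((P ×ˢ Finset.univ).filter
        fun e => f e = z).image Prod.fst) fun p hp => ?_) Finset.card_image_le
      simp only [Finset.mem_filter, not_forall, not_not] at hp
      obtain ⟨hp, b, hb⟩ := hp
      simp only [Finset.mem_image, Finset.mem_filter, Finset.mem_product, Finset.mem_univ, and_true]
      exact ⟨(p, b), ⟨hp, hb⟩, rfl⟩
    have hcard := Finset.card_le_card himg
    rw [Finset.card_erase_of_mem hz] at hcard
    have hpos := Finset.card_pos.2 ⟨z, hz⟩
    obtain ⟨w, hw⟩ := Nat.exists_eq_succ_of_ne_zero hpos.ne'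
    rw [hw] at hP hcard
    have hmul : d * ((P' ×ˢ Finset.univ).image f).card ≤ d * w :=
      Nat.mul_le_mul_left d (by simpa using hcard)
    have hP2 : d * ((P' ×ˢ Finset.univ).image f).card < P'.card := by
      rw [Nat.mul_succ] at hP
      omega
    have hss : P' ⊂ P := by
      refine hsub.ssubset_of_ne fun heq => ?_
      rw [Finset.mem_image] at hz
      obtain ⟨⟨p, b⟩, hp, hfz⟩ := hz
      have hp' : p ∈ P' := heq ▸ (Finset.mem_product.1 hp).1
      exact (Finset.mem_filter.1 hp').2 b hfz
    obtain ⟨Q, hQ, hne, hdeg⟩ := ih P' hss hP2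
    exact ⟨Q, hQ.trans hsub, hne, hdeg⟩

/-- A large set contains many disjoint pairs of elements of the same colour. -/
theorem exists_pairs [Fintype κ] [DecidableEq ι] (g : ι → κ) (N : ℕ) (U : Finset ι)
    (hU : 2 * N + Fintype.card κ ≤ U.card + 1) :
    ∃ P : Finset (Bool → ι), P.card = N ∧ (∀ p ∈ P, ∀ b, p b ∈ U) ∧
      (∀ p ∈ P, ∀ b, g (p b) = g (p true)) ∧
      Set.InjOn (fun e : (Bool → ι) × Bool => e.1 e.2)
        ((P ×ˢ Finset.univ : Finset ((Bool → ι) × Bool)) : Set _) := by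
  induction N generalizing U with
  | zero => exact ⟨∅, by simp⟩
  | succ N ih =>
    classical
    obtain ⟨u, hu, w, hw, huw, hg⟩ := Finset.exists_ne_map_eq_of_card_lt_of_maps_to
      (s := U) (t := Finset.univ) (f := g) (by rw [Finset.card_univ]; omega) (by simp)
    have hw' : w ∈ U.erase u := Finset.mem_erase.2 ⟨huw.symm, hw⟩
    obtain ⟨P, hN, hPU, hPg, hinj⟩ := ih ((U.erase u).erase w) (by
      rw [Finset.card_erase_of_mem hw', Finset.card_erase_of_mem hu]
      omega)
    have hPne : ∀ p ∈ P, ∀ b, p b ≠ w ∧ p b ≠ u ∧ p b ∈ U := fun p hp b => by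
      simpa using hPU p hp b
    set p₀ : Bool → ι := fun b => if b then u else w with hp₀
    have hnew : p₀ ∉ P := fun h => (hPne _ h true).2.1 rfl
    have hcase : ∀ b, p₀ b = u ∨ p₀ b = w := by simp [hp₀]
    refine ⟨insert p₀ P, by rw [Finset.card_insert_of_notMem hnew, hN], ?_, ?_, ?_⟩
    · intro p hp b
      rcases Finset.mem_insert.1 hp with rfl | hp
      · rcases hcase b with h | h <;> rw [h] <;> assumption
      · exact (hPne p hp b).2.2
    · intro p hp b
      rcases Finset.mem_insert.1 hp with rfl | hp
      · cases b <;> simp [hp₀, hg]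
      · exact hPg p hp b
    · rintro ⟨p, b⟩ hp ⟨p', b'⟩ hp' heq
      simp only [Finset.coe_product, Set.mem_prod, Finset.mem_coe, Finset.mem_insert] at hp hp'
      change p b = p' b' at heq
      rcases hp.1 with rfl | h1 <;> rcases hp'.1 with rfl | h2
      · cases b <;> cases b' <;> simp_all
      · rcases hcase b with h | h <;> have := hPne p' h2 b' <;> rw [h] at heq <;> tauto
      · rcases hcase b' with h | h <;> have := hPne p h1 b <;> rw [h] at heq <;> tauto
      · exact hinj (by simpa using h1) (by simpa using h2) heq

end Pairs

section Trees

variable {s : ℕ}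

/-- A tree probes a cell `i` and continues with the tree `f b` when `i` holds `b`. -/
theorem DTree.exists_eval_eq [NeZero s] {t : ℕ} (T : DTree s) (hT : T.depth ≤ t + 1) :
    ∃ (i : Fin s) (f : Bool → DTree s), (∀ b, (f b).depth ≤ t) ∧
      ∀ σ, T.eval σ = (f (σ i)).eval σ := by
  cases T with
  | leaf b => exact ⟨0, fun _ => .leaf b, fun _ => Nat.zero_le _, fun _ => rfl⟩
  | node i f0 f1 =>
    refine ⟨i, fun b => if b then f1 else f0, fun b => ?_, fun σ => ?_⟩
    · simp only [DTree.depth] at hT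
      cases b <;> simp <;> omega
    · cases h : σ i <;> simp [DTree.eval, h]

/-- The memory with an additional cell `none` that always holds `false`. -/
def extendMemory (σ : Fin s → Bool) (z : Option (Fin s)) : Bool :=
  z.elim false σ

/-- A tree of depth one reads one cell of the extended memory, up to negation. -/
theorem DTree.exists_eval_eq_xor [NeZero s] (T : DTree s) (hT : T.depth ≤ 1) :
    ∃ (z : Option (Fin s)) (c : Bool), ∀ σ, T.eval σ = xor (extendMemory σ z) c := by
  obtain ⟨i, f, hf, he⟩ := T.exists_eval_eq (t := 0) hT
  have hleaf : ∀ b, ∃ c, ∀ σ, (f b).eval σ = c := fun b => by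
    cases hfb : f b with
    | leaf c => exact ⟨c, fun _ => rfl⟩
    | node j g0 g1 =>
      have := hf b
      rw [hfb] at this
      simp [DTree.depth] at this
  choose g hg using hleaf
  by_cases hgg : g false = g true
  · refine ⟨none, g true, fun σ => ?_⟩
    cases h : σ i <;> simp [he, h, hg, extendMemory, hgg]
  · refine ⟨some i, g false, fun σ => ?_⟩
    cases h : σ i <;> cases h0 : g false <;> cases h1 : g true <;>
      simp_all [extendMemory]

/-- `A` can be labelled in such a way that no memory makes all trees of `A` answer correctly. -/
def Unsatisfiable {ι : Type*} (T : ι → DTree s) (A : Finset ι) : Prop :=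
  ∃ w : ι → Bool, ∀ σ, ∃ u ∈ A, (T u).eval σ ≠ w u

variable {ι : Type*} {T : ι → DTree s} {M : ℝ} {h : ℕ}

/-- Few trees of depth two are unsatisfiable. -/
theorem exists_unsatisfiable_of_depth_le_two (hT : ∀ u, (T u).depth ≤ 2)
    (hs : 16 ≤ s) (hM : 1 ≤ M) (hh : (s : ℝ) + 1 < M ^ h) (U : Finset ι)
    (hU : 15 * s * M < U.card) :
    ∃ A ⊆ U, A.card ≤ 8 * h + 4 ∧ Unsatisfiable T A := by
  classical
  have : NeZero s := ⟨by omega⟩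
  choose g f hf he using fun u => (T u).exists_eval_eq (hT u)
  choose z c hzc using fun u b => (f u b).exists_eval_eq_xor (hf u b)
  set d := ⌊6 * M⌋₊
  have hd1 : (d : ℝ) ≤ 6 * M := Nat.floor_le (by linarith)
  have hd2 : 6 * M < d + 1 := Nat.lt_floor_add_one _
  have hs' : (16 : ℝ) ≤ s := by exact_mod_cast hs
  have hN : 2 * (d * (s + 1) + 1) + s ≤ U.card + 1 := by
    have : (2 * (d * (s + 1) + 1) + s : ℝ) < U.card + 1 + 1 := by nlinarith
    exact Nat.lt_succ_iff.1 (by exact_mod_cast this)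
  obtain ⟨P, hP, hPU, hPg, hinj⟩ := exists_pairs g (d * (s + 1) + 1) U (by simpa using hN)
  obtain ⟨Q, hQP, ⟨p₀, hp₀⟩, hdeg⟩ := exists_subset_degree_gt
    (fun e : (Bool → ι) × Bool => z (e.1 e.2) e.2) d P (by
      rw [hP, Nat.lt_succ_iff]
      refine Nat.mul_le_mul_left d ((Finset.card_le_univ _).trans ?_)
      simp)
  obtain ⟨A, hAE, hA, q, hq⟩ := exists_not_obeys (x := fun e : (Bool → ι) × Bool => g (e.1 true))
    (y := fun e => z (e.1 e.2) e.2) (r := Prod.snd) (E := Q ×ˢ Finset.univ) (i := g (p₀ true))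
    (M := M) (h := h) (by linarith)
    (fun L => by
      refine Finset.card_bij' (fun e _ => (e.1, !e.2)) (fun e _ => (e.1, !e.2)) ?_ ?_ ?_ ?_ <;>
        simp [outEdges])
    (fun w hw => by
      have h1 := (Nat.cast_le (α := ℝ)).2 (hdeg w hw)
      push_cast at h1
      linarith)
    (fun v => ⟨(p₀, v), by simpa using hp₀, rfl, rfl⟩) (by simpa using hh)
  have : Nonempty ((Bool → ι) × Bool) := ⟨(p₀, true)⟩
  set el : (Bool → ι) × Bool → ι := fun e => e.1 e.2
  have hAP : A ⊆ P ×ˢ Finset.univ := hAE.trans (Finset.product_subset_product_left hQP)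
  have hinv := (hinj.mono (Finset.coe_subset.2 hAP)).leftInvOn_invFunOn
  set inv := Function.invFunOn el (A : Set _)
  refine ⟨A.image el, fun u hu => ?_, Finset.card_image_le.trans hA,
    fun u => xor (q (inv u)) (c u (inv u).2), fun σ => ?_⟩
  · obtain ⟨e, heA, rfl⟩ := Finset.mem_image.1 hu
    exact hPU _ (Finset.mem_product.1 (hAP heA)).1 _
  · by_contra! hall
    refine hq σ (extendMemory σ) fun e heA hx => ?_
    have h1 := hall (el e) (Finset.mem_image_of_mem _ heA)
    have h2 : g (el e) = g (e.1 true) := hPg _ (Finset.mem_product.1 (hAP heA)).1 _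
    change σ (g (e.1 true)) = e.2 at hx
    rw [hinv heA, he, h2, hx, hzc] at h1
    exact Bool.xor_left_inj.1 h1

/-- Few trees of depth `j + 2` are unsatisfiable. -/
theorem exists_unsatisfiable (hs : 16 ≤ s) (hM : 1 ≤ M) (hh : (s : ℝ) + 1 < M ^ h) (j : ℕ)
    (hj : 2 ^ j * (8 * h + 4) ≤ s) (hT : ∀ u, (T u).depth ≤ j + 2) (U : Finset ι)
    (hU : (15 * s : ℝ) ^ (j + 1) * M < U.card) :
    ∃ A ⊆ U, A.card ≤ 2 ^ j * (8 * h + 4) ∧ Unsatisfiable T A := by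
  classical
  induction j generalizing T U with
  | zero => simpa using exists_unsatisfiable_of_depth_le_two hT hs hM hh U (by simpa using hU)
  | succ j ih =>
    have : NeZero s := ⟨by omega⟩
    have hs' : (16 : ℝ) ≤ s := by exact_mod_cast hs
    choose g f hf he using fun u => (T u).exists_eval_eq (t := j + 2) (hT u)
    have hj' : 2 * (2 ^ j * (8 * h + 4)) ≤ s := by rw [← mul_assoc, ← pow_succ']; exact hj
    set K := 2 ^ j * (8 * h + 4) with hK
    have hpow : (s : ℝ) ≤ (15 * s) ^ (j + 1) * M := by
      have : (15 * s : ℝ) ≤ (15 * s) ^ (j + 1) := le_self_pow₀ (by linarith) (by omega)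
      nlinarith
    have hKs : (2 * K : ℝ) ≤ s := by exact_mod_cast hj'
    obtain ⟨i, -, hi⟩ := Finset.exists_lt_card_fiber_of_nsmul_lt_card_of_maps_to
      (s := U) (t := Finset.univ) (f := g) (b := (15 * s : ℝ) ^ (j + 1) * M + K) (by simp) (by
        rw [Finset.card_univ, Fintype.card_fin, nsmul_eq_mul]
        refine lt_of_le_of_lt ?_ hU
        rw [pow_succ (15 * s : ℝ) (j + 1)]
        nlinarith)
    set V := U.filter fun u => g u = i
    have hVU : V ⊆ U := Finset.filter_subset _ _
    obtain ⟨A, hAV, hA, w, hw⟩ := ih (T := fun u => f u false) (by omega) (fun u => hf u _) V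
      (by have : (0 : ℝ) ≤ K := Nat.cast_nonneg _
          linarith)
    obtain ⟨B, hBV, hB, w', hw'⟩ := ih (T := fun u => f u true) (by omega) (fun u => hf u _) (V \ A)
      (by
        have h1 := Finset.card_sdiff_add_card_eq_card hAV
        have h2 : ((V \ A).card : ℝ) + A.card = V.card := by exact_mod_cast h1
        have h3 : (A.card : ℝ) ≤ K := by exact_mod_cast hA
        linarith)
    have hBV' : B ⊆ V := hBV.trans Finset.sdiff_subset
    refine ⟨A ∪ B, (Finset.union_subset hAV hBV').trans hVU, ?_,
      fun u => if u ∈ A then w u else w' u, fun σ => ?_⟩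
    · rw [pow_succ', mul_assoc]
      exact (Finset.card_union_le _ _).trans (by omega)
    · cases hσ : σ i
      · obtain ⟨u, hu, hne⟩ := hw σ
        refine ⟨u, Finset.mem_union_left _ hu, ?_⟩
        simpa [he, (Finset.mem_filter.1 (hAV hu)).2, hσ, hu] using hne
      · obtain ⟨u, hu, hne⟩ := hw' σ
        refine ⟨u, Finset.mem_union_right _ hu, ?_⟩
        simpa [he, (Finset.mem_filter.1 (hBV' hu)).2, hσ, (Finset.mem_sdiff.1 (hBV hu)).2] using hne

end Trees

section Schemes

variable {m n s t : ℕ}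

/-- Storing the characteristic vector needs `m` bits and a single probe. -/
theorem schemeExists_self (ht : 1 ≤ t) : SchemeExists m n m t :=
  ⟨fun S u => decide (u ∈ S), fun u => .node u (.leaf false) (.leaf true),
    fun _ => by simpa [DTree.depth] using ht, fun S _ u => by simp [DTree.eval]⟩

/-- A scheme for sets of size `n` needs at least `n` bits. -/
theorem SchemeExists.le (h : SchemeExists m n s t) (hnm : n ≤ m) : n ≤ s := by
  obtain ⟨φ, T, -, hφ⟩ := h
  obtain ⟨V, -, hV⟩ := Finset.exists_subset_card_eq (s := (Finset.univ : Finset (Fin m)))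
    (n := n) (by simpa using hnm)
  have hle := Finset.card_le_card_of_injOn (s := V.powerset) (t := Finset.univ) φ (by simp)
    fun S hS S' hS' heq => by
      have hcard : ∀ W ∈ (V.powerset : Set (Finset (Fin m))), W.card ≤ n := fun W hW =>
        hV ▸ Finset.card_le_card (Finset.mem_powerset.1 hW)
      ext u
      rw [← hφ S (hcard S hS), ← hφ S' (hcard S' hS'), heq]
  rw [Finset.card_powerset, hV, Finset.card_univ, Fintype.card_fun, Fintype.card_bool,
    Fintype.card_fin] at hle
  exact (Nat.pow_le_pow_iff_right (by norm_num)).1 hle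

/-- The parameters for which a scheme is refuted by `exists_unsatisfiable`. -/
theorem not_schemeExists {j h : ℕ} {M : ℝ} (hs : 16 ≤ s) (hM : 1 ≤ M)
    (hh : (s : ℝ) + 1 < M ^ h) (hn : 2 ^ j * (8 * h + 4) ≤ n) (hns : n ≤ s)
    (hm : (15 * s : ℝ) ^ (j + 1) * M < m) : ¬ SchemeExists m n s (j + 2) := by
  rintro ⟨φ, T, hT, hφ⟩
  obtain ⟨A, -, hA, w, hw⟩ :=
    exists_unsatisfiable hs hM hh j (hn.trans hns) hT Finset.univ (by simpa using hm)
  obtain ⟨u, hu, hne⟩ := hw (φ (A.filter fun u => w u = true))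
  refine hne (Bool.eq_iff_iff.2 ?_)
  rw [hφ _ ((Finset.card_filter_le _ _).trans (hA.trans hn)), Finset.mem_filter]
  simp [hu]

end Schemes

/-- For all integers `t ≥ 2` and `m, n` with `4^t ≤ n ≤ m^(1/(2(t-1)))`,
`s(m,n,t) ≥ (1/15) · m^((1/(t-1))·(1 - 4^t/n))`. -/
theorem general_lower_bound :
    ∀ t m n : ℕ, 2 ≤ t → 4 ^ t ≤ n →
      (n : ℝ) ≤ (m : ℝ) ^ ((1 : ℝ) / (2 * ((t : ℝ) - 1))) →
      (1 / 15 : ℝ) * (m : ℝ) ^ (((1 : ℝ) / ((t : ℝ) - 1)) * (1 - (4 : ℝ) ^ t / (n : ℝ)))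
        ≤ (sFun m n t : ℝ) := by
  intro t m n ht hn hnm
  obtain ⟨j, rfl⟩ : ∃ j, t = j + 2 := ⟨t - 2, by omega⟩
  have hn16 : 16 ≤ n := le_trans (by rw [pow_add]; have := Nat.one_le_pow j 4; omega) hn
  have hp : ((j + 2 : ℕ) : ℝ) - 1 = (j + 1 : ℕ) := by push_cast; ring
  rw [hp] at hnm ⊢
  have hp1 : (1 : ℝ) ≤ (j + 1 : ℕ) := by exact_mod_cast Nat.succ_pos j
  set p : ℝ := ((j + 1 : ℕ) : ℝ) with hpdef
  have hm1 : 1 ≤ m := by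
    by_contra h0
    obtain rfl : m = 0 := by omega
    rw [Nat.cast_zero, Real.zero_rpow (by positivity)] at hnm
    have : n = 0 := by exact_mod_cast le_antisymm hnm (Nat.cast_nonneg n)
    omega
  have hm1' : (1 : ℝ) ≤ m := by exact_mod_cast hm1
  have hm0 : (0 : ℝ) < m := by linarith
  have hnm' : n ≤ m := by
    have : (m : ℝ) ^ (1 / (2 * p)) ≤ (m : ℝ) ^ (1 : ℝ) :=
      Real.rpow_le_rpow_of_exponent_le hm1' (by rw [div_le_one (by linarith)]; linarith)
    rw [Real.rpow_one] at this
    exact_mod_cast hnm.trans this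
  have hscheme : SchemeExists m n (sFun m n (j + 2)) (j + 2) :=
    Nat.sInf_mem (s := {s | SchemeExists m n s (j + 2)}) ⟨m, schemeExists_self (by omega)⟩
  set s := sFun m n (j + 2)
  have hns := hscheme.le hnm'
  have hn0 : (0 : ℝ) < n := by exact_mod_cast (by omega : 0 < n)
  have hn' : (4 : ℝ) ^ (j + 2) ≤ n := by exact_mod_cast hn
  set ε : ℝ := 4 ^ (j + 2) / n with hε
  have hε0 : 0 < ε := by positivity
  have hε1 : ε ≤ 1 := (div_le_one hn0).2 hn'
  by_contra! hlt
  have h15 : (15 * s : ℝ) < (m : ℝ) ^ (1 / p * (1 - ε)) := by linarith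
  have hs16 : (16 : ℝ) ≤ s := by exact_mod_cast hn16.trans hns
  set h := ⌊2 / ε - 1 / 2⌋₊
  have hτ : 1 ≤ 1 / ε := (one_le_div hε0).2 hε1
  have h2τ : 2 / ε = 2 * (1 / ε) := by ring
  have hh1 : (h : ℝ) ≤ 2 / ε - 1 / 2 := Nat.floor_le (by linarith)
  have hh2 : 2 / ε - 1 / 2 < h + 1 := Nat.lt_floor_add_one _
  refine not_schemeExists (M := (m : ℝ) ^ ε) (h := h) (hn16.trans hns)
    (Real.one_le_rpow hm1' hε0.le) ?_ ?_ hns ?_ hscheme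
  · rw [← Real.rpow_natCast, ← Real.rpow_mul hm0.le]
    have h1 : (m : ℝ) ^ (1 / p * (1 - ε)) ≤ (m : ℝ) ^ (ε * h) := by
      refine Real.rpow_le_rpow_of_exponent_le hm1' ?_
      have h3 : 1 / p * (1 - ε) ≤ 1 - ε :=
        mul_le_of_le_one_left (by linarith) ((div_le_one (by linarith)).2 hp1)
      have h4 : ε * (2 / ε - 3 / 2) ≤ ε * h := by gcongr; linarith
      have h5 : ε * (2 / ε - 3 / 2) = 2 - 3 / 2 * ε := by field_simp
      linarith
    linarith
  · have h1 : (2 : ℝ) ^ j * (8 * h + 4) ≤ n := by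
      calc (2 : ℝ) ^ j * (8 * h + 4) ≤ 4 ^ j * (16 * (1 / ε)) := by
            gcongr
            · norm_num
            · linarith
        _ = n := by
            rw [hε, pow_add]
            field_simp
            norm_num
    exact_mod_cast h1
  · calc (15 * s : ℝ) ^ (j + 1) * (m : ℝ) ^ ε
        < ((m : ℝ) ^ (1 / p * (1 - ε))) ^ (j + 1) * (m : ℝ) ^ ε := by gcongr
      _ = m := by
        rw [← Real.rpow_natCast, ← Real.rpow_mul hm0.le, ← Real.rpow_add hm0, ← hpdef]
        have : 1 / p * (1 - ε) * p + ε = 1 := by field_simp; ring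
        rw [this, Real.rpow_one]
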